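/- Let (P,T) be a hybrid program such that in each rule H ← C, L1,…,Ln of P all arguments of the head H = p(t̄) are variables, and every variable occurs at most once in H, L1,…,Ln (its remaining occurrences may be in the constraint C). Then (P,T) is congruent w.r.t. T. -/

import Mathlib

/- Formalization of the framework of "Hybrid Rules with Well-Founded Semantics"
   (Drabent, Małuszyński). -/

namespace HybridRules

/-- Variables. -/
abbrev Var := ℕ

/-- First-order terms over an alphabet `Func` of function symbols
(constants being function symbols of arity 0). -/
inductive Tm (Func : Type) : Type
  | var : Var → Tm Func
  | app : Func → List (Tm Func) → Tm Func

namespace Tm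

variable {Func : Type}

/-- Applying a substitution to a term. -/
def subst (θ : Var → Tm Func) : Tm Func → Tm Func
  | var v => θ v
  | app f ts => app f (ts.attach.map (fun t => subst θ t.1))
decreasing_by
  have := List.sizeOf_lt_of_mem t.2
  simp only [Tm.app.sizeOf_spec]
  omega

/-- The list of variable occurrences of a term. -/
def varsList : Tm Func → List Var
  | var v => [v]
  | app _ ts => (ts.attach.map (fun t => varsList t.1)).flatten
decreasing_by
  have := List.sizeOf_lt_of_mem t.2
  simp only [Tm.app.sizeOf_spec]
  omega

/-- The number of occurrences of the variable `x` in a term. -/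
def count (x : Var) : Tm Func → ℕ
  | var v => if v = x then 1 else 0
  | app _ ts => (ts.attach.map (fun t => count x t.1)).sum
decreasing_by
  have := List.sizeOf_lt_of_mem t.2
  simp only [Tm.app.sizeOf_spec]
  omega

/-- The set of variables of a term. -/
def vars (t : Tm Func) : Set Var := {v | v ∈ t.varsList}

/-- A term is ground if it contains no variables. -/
def Ground (t : Tm Func) : Prop := t.varsList = []

end Tm

variable {RP Func : Type}

/-- An atom `p(t₁,…,tₙ)` built from a (rule) predicate symbol and a list of terms. -/
structure Atom (RP Func : Type) where
  pred : RP
  args : List (Tm Func)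

namespace Atom

/-- Applying a substitution to an atom. -/
def subst (θ : Var → Tm Func) (a : Atom RP Func) : Atom RP Func :=
  ⟨a.pred, a.args.map (Tm.subst θ)⟩

/-- The set of variables of an atom. -/
def vars (a : Atom RP Func) : Set Var := {v | ∃ t ∈ a.args, v ∈ t.vars}

/-- A ground atom. -/
def Ground (a : Atom RP Func) : Prop := ∀ t ∈ a.args, t.Ground

/-- The number of occurrences of the variable `x` in an atom. -/
def count (x : Var) (a : Atom RP Func) : ℕ := (a.args.map (Tm.count x)).sum

end Atom

/-- A literal: `(true, A)` is the positive literal `A`,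
`(false, A)` is the negative literal `¬A`.  (Elements `(b,A)` with `A` a
ground atom also serve as the elements of `H ∪ ¬H`, where negated predicates
are treated as fresh predicates.) -/
abbrev Lit (RP Func : Type) := Bool × Atom RP Func

/-- Applying a substitution to a literal. -/
def Lit.subst (θ : Var → Tm Func) (l : Lit RP Func) : Lit RP Func := (l.1, l.2.subst θ)

/-- A ground literal. -/
def Lit.Ground (l : Lit RP Func) : Prop := l.2.Ground

/-- The negation of a literal. -/
def Lit.negate (l : Lit RP Func) : Lit RP Func := (!l.1, l.2)

/-- A rule (normal clause) `H ← B₁,…,Bₙ` of a normal logic program. -/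
structure NRule (RP Func : Type) where
  head : Atom RP Func
  body : List (Lit RP Func)

/-- A normal logic program: a finite set of rules. -/
structure NProgram (RP Func : Type) where
  rules : Set (NRule RP Func)
  finite : rules.Finite

/-- A rule of a (ground) definite program over `H ∪ ¬H`: the head is a
(possibly negative) literal, treating `¬p` as a fresh predicate. -/
structure GRule (RP Func : Type) where
  head : Lit RP Func
  body : List (Lit RP Func)

/-- A ground rule. -/
def GRule.Ground (r : GRule RP Func) : Prop :=
  Lit.Ground r.head ∧ ∀ b ∈ r.body, Lit.Ground b

/-- `ground(P)`: the set of ground instances of the rules of a normal program,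
viewed as rules over `H ∪ ¬H`. -/
def groundOf (P : NProgram RP Func) : Set (GRule RP Func) :=
  {r | ∃ R ∈ P.rules, ∃ θ : Var → Tm Func,
        r.head = (true, R.head.subst θ) ∧ r.body = R.body.map (Lit.subst θ) ∧ r.Ground}

/-- The Herbrand base: the set of ground atoms. -/
def HB : Set (Atom RP Func) := {a | a.Ground}

/-- A 3-valued Herbrand interpretation, as a subset of `H ∪ ¬H`
(signed ground atoms). -/
abbrev Interp (RP Func : Type) := Set (Lit RP Func)

/-- `I` is a 3-valued Herbrand interpretation: a set of signed ground atoms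
containing no atom together with its negation. -/
def ConsistentInterp (I : Interp RP Func) : Prop :=
  (∀ l ∈ I, Lit.Ground l) ∧ ∀ a : Atom RP Func, ¬ ((true, a) ∈ I ∧ (false, a) ∈ I)

/-- `M` is a (2-valued) model of the definite program `Q` over `H ∪ ¬H`. -/
def IsModelOf (Q : Set (GRule RP Func)) (M : Set (Lit RP Func)) : Prop :=
  ∀ r ∈ Q, (∀ b ∈ r.body, b ∈ M) → r.head ∈ M

/-- `M_Q`: the least (2-valued) Herbrand model of a definite program `Q`. -/
def leastModel (Q : Set (GRule RP Func)) : Set (Lit RP Func) :=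
  ⋂₀ {M | IsModelOf Q M}

/-- `Q/t I  =  Q ∪ { ¬A | ¬A ∈ I }`. -/
def progT (Q : Set (GRule RP Func)) (I : Interp RP Func) : Set (GRule RP Func) :=
  Q ∪ {r | ∃ a, (false, a) ∈ I ∧ r = ⟨(false, a), []⟩}

/-- `Q/tu I  =  Q ∪ { ¬A | A ∉ I, A ∈ H }`. -/
def progTU (Q : Set (GRule RP Func)) (I : Interp RP Func) : Set (GRule RP Func) :=
  Q ∪ {r | ∃ a, a ∈ HB ∧ (true, a) ∉ I ∧ r = ⟨(false, a), []⟩}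

/-- The operator `Ψ_Q(I) = (M_{Q/t I} ∩ H) ∪ ¬(H \ M_{Q/tu I})` on 3-valued
Herbrand interpretations, for a set `Q` of ground rules. -/
def psi (Q : Set (GRule RP Func)) (I : Interp RP Func) : Interp RP Func :=
  {l | l.1 = true ∧ l.2 ∈ HB ∧ l ∈ leastModel (progT Q I)} ∪
  {l | l.1 = false ∧ l.2 ∈ HB ∧ (true, l.2) ∉ leastModel (progTU Q I)}

/-- Transfinite iteration of `Ψ_Q`:
`Ψ↑0 = ∅`, `Ψ↑(β+1) = Ψ(Ψ↑β)`, and `Ψ↑λ = ⋃_{β<λ} Ψ↑β` at limits. -/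
noncomputable def psiIter (Q : Set (GRule RP Func)) (o : Ordinal) : Interp RP Func :=
  Ordinal.limitRecOn o ∅ (fun _ ih => psi Q ih)
    (fun o' _ ih => {l | ∃ o'', ∃ h : o'' < o', l ∈ ih o'' h})

end HybridRules

namespace HybridRules

variable {RP Func : Type}

/-- An abstract external (constraint) theory `T` over the constraint predicates,
the function symbols `Func` and the variables.  `Con` is the distinguished set
of constraints (closed under conjunction, disjunction, negation and existential
quantification), `Model` is the class of first-order models of `T` (each with
its carrier `dom M`), `satv M ν C` is satisfaction of the constraint `C` in the
model `M` under the valuation `ν`, `fv` gives the free variables of a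
constraint, `subst` applies a substitution, `ceq` is the equality predicate
`=`, and `restrict C V` existentially quantifies the free variables of `C`
that are not in `V` (the restriction `C|V`). -/
structure CTheory (Func : Type) : Type 2 where
  Con : Type
  Model : Type 1
  dom : Model → Type
  evalT : (M : Model) → (Var → dom M) → Tm Func → dom M
  satv : (M : Model) → (Var → dom M) → Con → Prop
  fv : Con → Set Var
  subst : (Var → Tm Func) → Con → Con
  conj : Con → Con → Con
  disj : Con → Con → Con
  neg : Con → Con
  ctrue : Con
  cfalse : Con
  ceq : Tm Func → Tm Func → Con
  restrict : Con → Set Var → Con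
  evalT_var : ∀ M ν v, evalT M ν (Tm.var v) = ν v
  evalT_ground : ∀ M ν ν' t, Tm.Ground t → evalT M ν t = evalT M ν' t
  satv_ctrue : ∀ M ν, satv M ν ctrue
  satv_cfalse : ∀ M ν, ¬ satv M ν cfalse
  satv_conj : ∀ M ν C D, satv M ν (conj C D) ↔ (satv M ν C ∧ satv M ν D)
  satv_disj : ∀ M ν C D, satv M ν (disj C D) ↔ (satv M ν C ∨ satv M ν D)
  satv_neg : ∀ M ν C, satv M ν (neg C) ↔ ¬ satv M ν C
  satv_ceq : ∀ M ν t u, satv M ν (ceq t u) ↔ evalT M ν t = evalT M ν u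
  satv_subst : ∀ M ν θ C, satv M ν (subst θ C) ↔ satv M (fun v => evalT M ν (θ v)) C
  satv_restrict : ∀ M ν C V,
    satv M ν (restrict C V) ↔ ∃ ν', (∀ v ∈ V, ν' v = ν v) ∧ satv M ν' C
  satv_fv : ∀ M ν ν' C, (∀ v ∈ fv C, ν v = ν' v) → (satv M ν C ↔ satv M ν' C)

namespace CTheory

variable {Func : Type} (CT : CTheory Func)

/-- Truth of a (closed) constraint in a model: `M ⊨ C`. -/
def msat (M : CT.Model) (C : CT.Con) : Prop := ∀ ν, CT.satv M ν C

/-- `T ⊨ C`: the constraint holds in every model of `T` under every valuation. -/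
def entails (C : CT.Con) : Prop := ∀ M ν, CT.satv M ν C

/-- Satisfiability of a constraint w.r.t. `T`. -/
def satisfiable (C : CT.Con) : Prop := ∃ M ν, CT.satv M ν C

/-- Logical equivalence of constraints w.r.t. `T`. -/
def cequiv (C D : CT.Con) : Prop := ∀ M ν, CT.satv M ν C ↔ CT.satv M ν D

/-- Implication of constraints. -/
def cimp (C D : CT.Con) : CT.Con := CT.disj (CT.neg C) D

/-- `M` is a Herbrand interpretation: every element of its domain is the value
of exactly one ground term. -/
def IsHerbrand (M : CT.Model) : Prop :=
  ∃ ν : Var → CT.dom M,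
    Function.Bijective (fun t : {t : Tm Func // t.Ground} => CT.evalT M ν t.1)

end CTheory

/-- `θ` is a grounding substitution for the variables in `V`. -/
def GroundingOn (θ : Var → Tm Func) (V : Set Var) : Prop := ∀ v ∈ V, (θ v).Ground

/-- The set of constraints has the witness property: whenever `M ⊨ ∃C` then
`M ⊨ Cθ` for some substitution `θ` grounding the free variables of `C`. -/
def WitnessProperty (CT : CTheory Func) : Prop :=
  ∀ (M : CT.Model) (C : CT.Con), (∃ ν, CT.satv M ν C) →
    ∃ θ : Var → Tm Func, GroundingOn θ (CT.fv C) ∧ CT.msat M (CT.subst θ C)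

/-- A hybrid rule `H ← C, L₁,…,Lₙ` with constraint `C`. -/
structure HRule (RP Func : Type) (CT : CTheory Func) where
  head : Atom RP Func
  con : CT.Con
  body : List (Lit RP Func)

/-- The variables of a hybrid rule. -/
def HRule.vars {CT : CTheory Func} (R : HRule RP Func CT) : Set Var :=
  R.head.vars ∪ CT.fv R.con ∪ {v | ∃ l ∈ R.body, v ∈ Atom.vars l.2}

/-- A hybrid program `(P,T)`: a finite set of hybrid rules over the external
theory `T` (represented by `CT`). -/
structure HProgram (RP Func : Type) (CT : CTheory Func) where
  rules : Set (HRule RP Func CT)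
  finite : rules.Finite

/-- `P/M₀`: the normal (ground) program obtained from `ground(P)` by removing
each rule constraint true in `M₀` and removing each rule whose constraint is
not true in `M₀`. -/
def progMod (CT : CTheory Func) (P : HProgram RP Func CT) (M : CT.Model) :
    Set (GRule RP Func) :=
  {r | ∃ R ∈ P.rules, ∃ θ : Var → Tm Func, GroundingOn θ (HRule.vars R) ∧
        CT.msat M (CT.subst θ R.con) ∧
        r.head = (true, R.head.subst θ) ∧ r.body = R.body.map (Lit.subst θ)}

/-- The well-founded model `WF(Q)` of a ground normal program `Q`: the least
fixed point of `Ψ_Q` (as the least pre-fixed point, by Knaster–Tarski). -/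
def wfm (Q : Set (GRule RP Func)) : Interp RP Func := ⋂₀ {I | psi Q I ⊆ I}

/-- `(P,T) ⊨_wf A` for a ground atom `A`: `A` is true in the well-founded model
of `P` based on `M₀`, for every model `M₀` of `T`. -/
def wfTrue (CT : CTheory Func) (P : HProgram RP Func CT) (A : Atom RP Func) : Prop :=
  ∀ M : CT.Model, (true, A) ∈ wfm (progMod CT P M)

/-- `(P,T) ⊨_wf ¬A` for a ground atom `A`. -/
def wfFalse (CT : CTheory Func) (P : HProgram RP Func CT) (A : Atom RP Func) : Prop :=
  ∀ M : CT.Model, (false, A) ∈ wfm (progMod CT P M)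

/-- `(P,T) ⊨_wf L₁ ∧ … ∧ Lₙ` for a (possibly non-ground) conjunction of rule
literals: every ground instance of every literal is true in every well-founded
model of `(P,T)`. -/
def wfLits (CT : CTheory Func) (P : HProgram RP Func CT) (ls : List (Lit RP Func)) : Prop :=
  ∀ (M : CT.Model) (σ : Var → Tm Func), (∀ l ∈ ls, Lit.Ground (Lit.subst σ l)) →
    ∀ l ∈ ls, Lit.subst σ l ∈ wfm (progMod CT P M)

/-- `(P,T) ⊨_wf ¬(L₁ ∧ … ∧ Lₙ)`: in every well-founded model, every ground
instance of the conjunction is false, i.e. contains a false literal. -/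
def wfNegLits (CT : CTheory Func) (P : HProgram RP Func CT) (ls : List (Lit RP Func)) : Prop :=
  ∀ (M : CT.Model) (σ : Var → Tm Func), (∀ l ∈ ls, Lit.Ground (Lit.subst σ l)) →
    ∃ l ∈ ls, Lit.negate (Lit.subst σ l) ∈ wfm (progMod CT P M)

/-- Truth of a rule atom in a model `M` of `T` expanded by an interpretation
`ρ` of the rule predicates over the domain of `M`. -/
def atomHolds (CT : CTheory Func) (M : CT.Model) (ν : Var → CT.dom M)
    (ρ : RP → List (CT.dom M) → Prop) (a : Atom RP Func) : Prop :=
  ρ a.pred (a.args.map (CT.evalT M ν))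

/-- Truth of a rule literal in such an expanded model. -/
def litHolds (CT : CTheory Func) (M : CT.Model) (ν : Var → CT.dom M)
    (ρ : RP → List (CT.dom M) → Prop) (l : Lit RP Func) : Prop :=
  if l.1 then atomHolds CT M ν ρ l.2 else ¬ atomHolds CT M ν ρ l.2

/-- Truth of a hybrid rule, read as the first-order implication
`∀ (C ∧ L₁ ∧ … ∧ Lₙ → H)`, in an expanded model. -/
def hruleHolds (CT : CTheory Func) (M : CT.Model)
    (ρ : RP → List (CT.dom M) → Prop) (R : HRule RP Func CT) : Prop :=
  ∀ ν, CT.satv M ν R.con → (∀ l ∈ R.body, litHolds CT M ν ρ l) →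
    atomHolds CT M ν ρ R.head

/-- The constraint `t₁ = u₁ ∧ … ∧ tₙ = uₙ`. -/
def eqList (CT : CTheory Func) (ts us : List (Tm Func)) : CT.Con :=
  (List.zipWith CT.ceq ts us).foldr CT.conj CT.ctrue

/-- `P` is congruent for the predicate `p` w.r.t. `T`: whenever
`T ⊨ t₁='u₁ ∧ … ∧ tₙ='uₙ` (for ground terms), `(P,T) ⊨_wf p(t̄)` iff
`(P,T) ⊨_wf p(ū)`. -/
def CongruentFor (CT : CTheory Func) (P : HProgram RP Func CT) (p : RP) : Prop :=
  ∀ ts us : List (Tm Func), ts.length = us.length →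
    (∀ t ∈ ts, t.Ground) → (∀ u ∈ us, u.Ground) →
    CT.entails (eqList CT ts us) →
    (wfTrue CT P ⟨p, ts⟩ ↔ wfTrue CT P ⟨p, us⟩)

/-- `P` is congruent w.r.t. `T` if it is congruent for every rule predicate. -/
def Congruent (CT : CTheory Func) (P : HProgram RP Func CT) : Prop :=
  ∀ p : RP, CongruentFor CT P p

end HybridRules

namespace HybridRules

theorem Tm.subst_congr_count {Func : Type} (θ θ' : Var → Tm Func) :
    ∀ t : Tm Func, (∀ x, Tm.count x t ≠ 0 → θ x = θ' x) → Tm.subst θ t = Tm.subst θ' t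
  | .var v, h => by
      rw [Tm.subst, Tm.subst]
      exact h v (by rw [Tm.count]; simp)
  | .app f ts, h => by
      rw [Tm.subst, Tm.subst]
      congr 1
      apply List.map_congr_left
      rintro ⟨t, ht⟩ _
      apply Tm.subst_congr_count θ θ' t
      intro x hx
      apply h x
      rw [Tm.count]
      intro h0
      rw [List.sum_eq_zero_iff] at h0
      exact hx (h0 _ (List.mem_map.2 ⟨⟨t, ht⟩, List.mem_attach _ _, rfl⟩))
decreasing_by
  have := List.sizeOf_lt_of_mem ht
  simp only [Tm.app.sizeOf_spec]
  omega

theorem Lit.subst_congr_count {RP Func : Type} (θ θ' : Var → Tm Func) (l : Lit RP Func)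
    (h : ∀ x, Atom.count x l.2 ≠ 0 → θ x = θ' x) : Lit.subst θ l = Lit.subst θ' l := by
  unfold Lit.subst Atom.subst
  congr 2
  apply List.map_congr_left
  intro t ht
  apply Tm.subst_congr_count
  intro x hx
  apply h x
  intro h0
  unfold Atom.count at h0
  rw [List.sum_eq_zero_iff] at h0
  exact hx (h0 _ (List.mem_map.2 ⟨t, ht, rfl⟩))

theorem exists_upd {Func : Type} (Rel : Tm Func → Tm Func → Prop) (θ : Var → Tm Func) :
    ∀ (vs : List Var) (us : List (Tm Func)), vs.Nodup → List.Forall₂ Rel (vs.map θ) us →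
      ∃ θ' : Var → Tm Func, vs.map θ' = us ∧ (∀ v, v ∉ vs → θ' v = θ v) ∧
        ∀ v ∈ vs, Rel (θ v) (θ' v)
  | [], us, _, h => by
      cases h
      exact ⟨θ, by simp⟩
  | v :: vs, us, hn, h => by
      rw [List.map_cons] at h
      cases h with
      | @cons _ u _ us' h1 h2 =>
        obtain ⟨hv, hn'⟩ := List.nodup_cons.1 hn
        obtain ⟨θ', a, b, c⟩ := exists_upd Rel θ vs us' hn' h2
        have key : ∀ w ∈ vs, Function.update θ' v u w = θ' w := by
          intro w hw
          have hne : w ≠ v := by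
            rintro rfl
            exact hv hw
          exact Function.update_of_ne hne _ _
        refine ⟨Function.update θ' v u, ?_, ?_, ?_⟩
        · rw [List.map_cons, Function.update_self, List.map_congr_left key, a]
        · intro w hw
          rw [List.mem_cons, not_or] at hw
          rw [Function.update_of_ne hw.1]
          exact b w hw.2
        · intro w hw
          rcases List.mem_cons.1 hw with rfl | hw
          · rw [Function.update_self]; exact h1
          · rw [key w hw]; exact c w hw

theorem leastModel_mono {RP Func : Type} {Q Q' : Set (GRule RP Func)} (h : Q ⊆ Q') :
    leastModel Q ⊆ leastModel Q' := by
  intro l hl M hM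
  exact hl M (fun r hr => hM r (h hr))

theorem leastModel_isModel {RP Func : Type} (Q : Set (GRule RP Func)) :
    IsModelOf Q (leastModel Q) := by
  intro r hr hb M hM
  exact hM r hr (fun b hb' => hb b hb' M hM)

theorem leastModel_supported {RP Func : Type} {Q : Set (GRule RP Func)} {l : Lit RP Func}
    (hl : l ∈ leastModel Q) : ∃ r ∈ Q, r.head = l ∧ ∀ b ∈ r.body, b ∈ leastModel Q := by
  by_contra hc
  push Not at hc
  have := hl (leastModel Q \ {l}) (by
    intro r hr hb
    refine ⟨leastModel_isModel Q r hr (fun b h => (hb b h).1), ?_⟩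
    intro he
    obtain ⟨b, hb1, hb2⟩ := hc r hr he
    exact hb2 (hb b hb1).1)
  exact this.2 rfl

theorem psi_mono {RP Func : Type} (Q : Set (GRule RP Func)) {I J : Interp RP Func}
    (h : I ⊆ J) : psi Q I ⊆ psi Q J := by
  rintro l (⟨a, b, c⟩ | ⟨a, b, c⟩)
  · refine Or.inl ⟨a, b, leastModel_mono ?_ c⟩
    rintro r (hr | ⟨x, hx, e⟩)
    · exact Or.inl hr
    · exact Or.inr ⟨x, h hx, e⟩
  · refine Or.inr ⟨a, b, fun h' => c (leastModel_mono ?_ h')⟩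
    rintro r (hr | ⟨x, hx, hx', e⟩)
    · exact Or.inl hr
    · exact Or.inr ⟨x, hx, fun hh => hx' (h hh), e⟩

theorem psi_wfm_subset {RP Func : Type} (Q : Set (GRule RP Func)) : psi Q (wfm Q) ⊆ wfm Q := by
  intro l hl I hI
  have hsub : wfm Q ⊆ I := fun x hx => hx I hI
  exact hI (psi_mono Q hsub hl)

theorem wfm_subset_psi {RP Func : Type} (Q : Set (GRule RP Func)) : wfm Q ⊆ psi Q (wfm Q) := by
  intro l hl
  exact hl _ (psi_mono Q (psi_wfm_subset Q))

theorem eqList_forall {Func : Type} (CT : CTheory Func) (M : CT.Model) :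
    ∀ ts us : List (Tm Func), ts.length = us.length → (∀ u ∈ us, u.Ground) →
      (∀ ν, CT.satv M ν (eqList CT ts us)) →
      List.Forall₂ (fun t u => u.Ground ∧ ∀ ν, CT.evalT M ν t = CT.evalT M ν u) ts us
  | [], [], _, _, _ => .nil
  | [], _ :: _, h, _, _ => by simp at h
  | _ :: _, [], h, _, _ => by simp at h
  | t :: ts, u :: us, h, hu, hs => by
      have hs' : ∀ ν, CT.satv M ν (CT.ceq t u) ∧ CT.satv M ν (eqList CT ts us) :=
        fun ν => (CT.satv_conj M ν _ _).1 (hs ν)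
      refine .cons ⟨hu u (by simp), fun ν => (CT.satv_ceq M ν t u).1 (hs' ν).1⟩ ?_
      exact eqList_forall CT M ts us (by simpa using h) (fun u h => hu u (by simp [h]))
        (fun ν => (hs' ν).2)

theorem count_vars {Func : Type} (x : Var) : ∀ vs : List Var,
    ((vs.map (Tm.var (Func := Func))).map (Tm.count x)).sum = vs.count x
  | [] => rfl
  | v :: vs => by
      rw [List.map_cons, List.map_cons, List.sum_cons, count_vars x vs, List.count_cons, Tm.count]
      simp only [beq_iff_eq]
      omega

theorem exists_var_list {Func : Type} : ∀ ts : List (Tm Func),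
    (∀ t ∈ ts, ∃ v : Var, t = Tm.var v) → ∃ vs : List Var, ts = vs.map Tm.var
  | [], _ => ⟨[], rfl⟩
  | t :: ts, h => by
      obtain ⟨v, rfl⟩ := h t (by simp)
      obtain ⟨vs, rfl⟩ := exists_var_list ts (fun t ht => h t (by simp [ht]))
      exact ⟨v :: vs, rfl⟩

theorem wfm_transfer {RP Func : Type} (CT : CTheory Func)
    (P : HProgram RP Func CT)
    (hheadvars : ∀ R ∈ P.rules, ∀ t ∈ R.head.args, ∃ v : Var, t = Tm.var v)
    (honce : ∀ R ∈ P.rules, ∀ x : Var,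
      Atom.count x R.head + (R.body.map (fun l => Atom.count x l.2)).sum ≤ 1)
    (M : CT.Model) (p : RP) (ts us : List (Tm Func)) (hu : ∀ u ∈ us, u.Ground)
    (hr : List.Forall₂ (fun t u => u.Ground ∧ ∀ ν, CT.evalT M ν t = CT.evalT M ν u) ts us)
    (h : ((true, ⟨p, ts⟩) : Lit RP Func) ∈ wfm (progMod CT P M)) :
    ((true, ⟨p, us⟩) : Lit RP Func) ∈ wfm (progMod CT P M) := by
  apply psi_wfm_subset
  rcases wfm_subset_psi _ h with ⟨-, -, hl⟩ | ⟨hf, -⟩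
  swap
  · simp at hf
  refine Or.inl ⟨rfl, hu, ?_⟩
  obtain ⟨r, hrQ, hhead, hbody⟩ := leastModel_supported hl
  rcases hrQ with hrQ | ⟨a, -, rfl⟩
  swap
  · simp at hhead
  obtain ⟨R, hR, θ, hg, hsat, hh, hb⟩ := hrQ
  obtain ⟨vs, hvs⟩ := exists_var_list _ (hheadvars R hR)
  have hcount : ∀ x, Atom.count x R.head = vs.count x := by
    intro x
    unfold Atom.count
    rw [hvs, count_vars]
  have hnd : vs.Nodup := by
    rw [List.nodup_iff_count_le_one]
    intro x
    have := honce R hR x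
    rw [hcount] at this
    omega
  have hmap : ∀ σ : Var → Tm Func, R.head.subst σ = ⟨R.head.pred, vs.map σ⟩ := by
    intro σ
    unfold Atom.subst
    rw [hvs, List.map_map]
    congr 1
    apply List.map_congr_left
    intro v _
    simp [Tm.subst]
  rw [hh, hmap] at hhead
  simp only [Prod.mk.injEq, true_and, Atom.mk.injEq] at hhead
  obtain ⟨hp, hts⟩ := hhead
  rw [← hts] at hr
  obtain ⟨θ', h1, h2, h3⟩ := exists_upd _ θ vs us hnd hr
  have heval : ∀ ν v, CT.evalT M ν (θ' v) = CT.evalT M ν (θ v) := by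
    intro ν v
    by_cases hv : v ∈ vs
    · exact ((h3 v hv).2 ν).symm
    · rw [h2 v hv]
  have hbody' : R.body.map (Lit.subst θ') = R.body.map (Lit.subst θ) := by
    apply List.map_congr_left
    intro l hl
    apply Lit.subst_congr_count
    intro x hx
    apply h2
    intro hxv
    have := honce R hR x
    rw [hcount] at this
    have h4 : 0 < vs.count x := List.count_pos_iff.2 hxv
    have h5 : (R.body.map (fun l => Atom.count x l.2)).sum = 0 := by omega
    rw [List.sum_eq_zero_iff] at h5
    exact hx (h5 _ (List.mem_map.2 ⟨l, hl, rfl⟩))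
  have hmod := leastModel_isModel (progT (progMod CT P M) (wfm (progMod CT P M)))
    ⟨(true, ⟨p, us⟩), r.body⟩
  refine hmod (Or.inl ⟨R, hR, θ', ?_, ?_, ?_, ?_⟩) hbody
  · intro v hv
    by_cases hv' : v ∈ vs
    · exact (h3 v hv').1
    · rw [h2 v hv']; exact hg v hv
  · intro ν
    rw [CT.satv_subst]
    have := hsat ν
    rw [CT.satv_subst] at this
    rwa [funext (heval ν)]
  · simp only [hmap, h1, hp]
  · simp only [hb, hbody']

/-- If in each rule `H ← C, L₁,…,Lₙ` of `P` all arguments of the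
head `H = p(t̄)` are variables and every variable occurs at most once in
`H, L₁,…,Lₙ` (its remaining occurrences may be in `C`), then `(P,T)` is
congruent w.r.t. `T`. -/
theorem syntactic_congruent {RP Func : Type} (CT : CTheory Func)
    (P : HProgram RP Func CT)
    (hheadvars : ∀ R ∈ P.rules, ∀ t ∈ R.head.args, ∃ v : Var, t = Tm.var v)
    (honce : ∀ R ∈ P.rules, ∀ x : Var,
      Atom.count x R.head + (R.body.map (fun l => Atom.count x l.2)).sum ≤ 1) :
    Congruent CT P := by
  intro p ts us hlen hts hus he
  constructor
  · intro h M
    exact wfm_transfer CT P hheadvars honce M p ts us hus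
      (eqList_forall CT M ts us hlen hus (he M)) (h M)
  · intro h M
    refine wfm_transfer CT P hheadvars honce M p us ts hts ?_ (h M)
    have h1 := eqList_forall CT M ts us hlen hus (he M)
    rw [List.forall₂_iff_get] at h1 ⊢
    refine ⟨h1.1.symm, fun i hi hj => ⟨hts _ (List.get_mem _ _), fun ν => ?_⟩⟩
    exact ((h1.2 i hj hi).2 ν).symm

end HybridRules
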